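/- (The Green function solves the free Dirac equation away from the origin.) Let m, c > 0 and λ ∈ ℂ ∖ ((−∞, −mc²] ∪ [mc², ∞)). Then the matrix-valued function G_λ is differentiable (entrywise) on ℝ³ ∖ {0}, and for every x ∈ ℝ³ ∖ {0}: −i c Σ_{j=1}^{3} αⱼ ∂ⱼ G_λ(x) + m c² β G_λ(x) − λ G_λ(x) = 0, where ∂ⱼ G_λ denotes the entrywise partial derivative in the j-th coordinate direction. -/

import Mathlib

open Matrix

noncomputable section

/-- The Pauli matrices. -/
def pauli : Fin 3 → Matrix (Fin 2) (Fin 2) ℂ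
  | 0 => !![0, 1; 1, 0]
  | 1 => !![0, -Complex.I; Complex.I, 0]
  | 2 => !![1, 0; 0, -1]

/-- The Dirac matrices α₁, α₂, α₃. -/
def diracAlpha (j : Fin 3) : Matrix (Fin 4) (Fin 4) ℂ :=
  Matrix.reindex finSumFinEquiv finSumFinEquiv (Matrix.fromBlocks 0 (pauli j) (pauli j) 0)

/-- The Dirac matrix β. -/
def diracBeta : Matrix (Fin 4) (Fin 4) ℂ :=
  Matrix.reindex finSumFinEquiv finSumFinEquiv ((Matrix.fromBlocks 1 0 0 (-1) : Matrix (Fin 2 ⊕ Fin 2) (Fin 2 ⊕ Fin 2) ℂ))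

/-- The matrix γ₅. -/
def gammaFive : Matrix (Fin 4) (Fin 4) ℂ :=
  Matrix.reindex finSumFinEquiv finSumFinEquiv ((Matrix.fromBlocks 0 1 1 0 : Matrix (Fin 2 ⊕ Fin 2) (Fin 2 ⊕ Fin 2) ℂ))

/-- α·x for x ∈ ℝ³. -/
def alphaDot (x : EuclideanSpace ℝ (Fin 3)) : Matrix (Fin 4) (Fin 4) ℂ :=
  ∑ j : Fin 3, (x j : ℂ) • diracAlpha j

/-- The (η,τ)-jump condition. -/
def JumpCond (c η τ : ℝ) (ν : EuclideanSpace ℝ (Fin 3)) (u v : Fin 4 → ℂ) : Prop :=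
  (Complex.I * (c : ℂ)) • ((alphaDot ν) *ᵥ (u - v)) +
    ((1 : ℂ) / 2) • ((((η : ℂ) • (1 : Matrix (Fin 4) (Fin 4) ℂ) + (τ : ℂ) • diracBeta)) *ᵥ (u + v)) = 0

/-- The Green function of the free Dirac operator, with `k = k(λ)` the branch of
`√(λ²/c² − (mc)²)` with positive imaginary part supplied as a parameter. -/
def greenFun (m c : ℝ) (lam k : ℂ) (x : EuclideanSpace ℝ (Fin 3)) :
    Matrix (Fin 4) (Fin 4) ℂ :=
  (Complex.exp (Complex.I * k * (‖x‖ : ℂ)) / (4 * (Real.pi : ℂ) * (‖x‖ : ℂ))) •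
    ((lam / (c : ℂ) ^ 2) • (1 : Matrix (Fin 4) (Fin 4) ℂ) + (m : ℂ) • diracBeta +
      ((1 - Complex.I * k * (‖x‖ : ℂ)) * (Complex.I / ((c : ℂ) * (‖x‖ : ℂ) ^ 2))) • alphaDot x)


lemma hasFDerivAt_norm_of_ne_zero {E : Type*} [NormedAddCommGroup E] [InnerProductSpace ℝ E]
    {x : E} (hx : x ≠ 0) :
    HasFDerivAt (fun y : E => ‖y‖) (‖x‖⁻¹ • innerSL ℝ x) x := by
  have h := (hasStrictFDerivAt_norm_sq x).hasFDerivAt.sqrt (by positivity)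
  simp only [Real.sqrt_sq (norm_nonneg _)] at h
  convert h using 1
  ext v
  simp
  field_simp

/-- Differentiability and coordinate derivatives of a radial function. -/
lemma hasFDerivAt_radial {E : Type*} [NormedAddCommGroup E] [InnerProductSpace ℝ E]
    {f : ℂ → ℂ} {f' : ℂ} {x : E} (hx : x ≠ 0) (hf : HasDerivAt f f' (‖x‖ : ℂ)) :
    HasFDerivAt (fun y : E => f (‖y‖ : ℂ))
      ((‖x‖⁻¹ • innerSL ℝ x : E →L[ℝ] ℝ).smulRight f') x :=
  hf.comp_ofReal.hasFDerivAt.comp x (hasFDerivAt_norm_of_ne_zero hx) |>.congr_fderiv (by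
    ext v
    simp [mul_assoc])

lemma diracBeta_mul_self : diracBeta * diracBeta = 1 := by
  simp only [diracBeta, Matrix.reindex_apply, Matrix.submatrix_mul_equiv, Matrix.fromBlocks_multiply]
  simp

lemma sum_diracAlpha_mul_self : ∑ j, diracAlpha j * diracAlpha j = (3 : ℂ) • 1 := by
  have h : ∀ j, pauli j * pauli j = 1 := by
    intro j
    fin_cases j <;> ext a b <;> fin_cases a <;> fin_cases b <;>
      simp [pauli, Matrix.mul_apply]
  have h' : ∀ j, diracAlpha j * diracAlpha j = 1 := by
    intro j
    simp only [diracAlpha, Matrix.reindex_apply, Matrix.submatrix_mul_equiv,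
      Matrix.fromBlocks_multiply, h]
    simp
  simp [h', ← Nat.cast_smul_eq_nsmul ℂ]

lemma diracBeta_anticomm_alphaDot (x : EuclideanSpace ℝ (Fin 3)) :
    diracBeta * alphaDot x = -(alphaDot x * diracBeta) := by
  have h : ∀ j, diracBeta * diracAlpha j = -(diracAlpha j * diracBeta) := by
    intro j
    simp only [diracAlpha, diracBeta, Matrix.reindex_apply, Matrix.submatrix_mul_equiv,
      Matrix.fromBlocks_multiply]
    ext a b
    simp only [Matrix.neg_apply, Matrix.submatrix_apply]
    rw [← Matrix.neg_apply, Matrix.fromBlocks_neg]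
    simp
  simp [alphaDot, Finset.mul_sum, Finset.sum_mul, h]

lemma alphaDot_eq (x : EuclideanSpace ℝ (Fin 3)) :
    alphaDot x = Matrix.reindex finSumFinEquiv finSumFinEquiv
      (Matrix.fromBlocks 0 (∑ j, (x j : ℂ) • pauli j) (∑ j, (x j : ℂ) • pauli j) 0) := by
  ext a b
  obtain ⟨a, rfl⟩ := (finSumFinEquiv (m := 2) (n := 2)).surjective a
  obtain ⟨b, rfl⟩ := (finSumFinEquiv (m := 2) (n := 2)).surjective b
  rcases a with a | a <;> rcases b with b | b <;>
    simp [alphaDot, diracAlpha, Matrix.sum_apply]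

lemma alphaDot_mul_self (x : EuclideanSpace ℝ (Fin 3)) :
    alphaDot x * alphaDot x = ((‖x‖ : ℂ) ^ 2) • 1 := by
  have hn : ((‖x‖ : ℂ) ^ 2) = (x 0 : ℂ) ^ 2 + (x 1 : ℂ) ^ 2 + (x 2 : ℂ) ^ 2 := by
    have := EuclideanSpace.real_norm_sq_eq x
    rw [Fin.sum_univ_three] at this
    exact_mod_cast this
  have h : (∑ j, (x j : ℂ) • pauli j) * (∑ j, (x j : ℂ) • pauli j) = ((‖x‖ : ℂ) ^ 2) • 1 := by
    rw [hn]
    ext a b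
    fin_cases a <;> fin_cases b <;>
      simp [pauli, Matrix.mul_apply, Fin.sum_univ_three] <;> ring_nf <;> simp
  rw [alphaDot_eq]
  simp only [Matrix.reindex_apply, Matrix.submatrix_mul_equiv, Matrix.fromBlocks_multiply, h]
  ext a b
  obtain ⟨a, rfl⟩ := (finSumFinEquiv (m := 2) (n := 2)).surjective a
  obtain ⟨b, rfl⟩ := (finSumFinEquiv (m := 2) (n := 2)).surjective b
  rcases a with a | a <;> rcases b with b | b <;> simp [Matrix.one_apply]

/-- The radial factor `e^{ikr} / (4πr)` of the Green function. -/
def radialFactor (k r : ℂ) : ℂ :=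
  Complex.exp (Complex.I * k * r) / (4 * (Real.pi : ℂ) * r)

/-- The radial coefficient of `α·x` in the Green function. -/
def alphaFactor (c k r : ℂ) : ℂ :=
  radialFactor k r * ((1 - Complex.I * k * r) * (Complex.I / (c * r ^ 2)))

lemma hasDerivAt_radialFactor {c k r : ℂ} (hc : c ≠ 0) (hr : r ≠ 0) :
    HasDerivAt (radialFactor k) (r * (Complex.I * c * alphaFactor c k r)) r := by
  have hpi : (Real.pi : ℂ) ≠ 0 := by exact_mod_cast Real.pi_ne_zero
  have he : HasDerivAt (fun r => Complex.exp (Complex.I * k * r))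
      (Complex.exp (Complex.I * k * r) * (Complex.I * k)) r := by
    simpa using ((hasDerivAt_id r).const_mul (Complex.I * k)).cexp
  have hd : HasDerivAt (fun r : ℂ => 4 * (Real.pi : ℂ) * r) (4 * Real.pi) r := by
    simpa using (hasDerivAt_id r).const_mul (4 * (Real.pi : ℂ))
  refine (he.div hd (by simp [hpi, hr])).congr_deriv ?_
  simp only [alphaFactor, radialFactor]
  field_simp
  linear_combination (-1 + Complex.I * k * r) * Complex.I_sq

lemma hasDerivAt_alphaFactor {c k r : ℂ} (hc : c ≠ 0) (hr : r ≠ 0) :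
    HasDerivAt (alphaFactor c k)
      ((Complex.I / c * k ^ 2 * radialFactor k r - 3 * alphaFactor c k r) / r) r := by
  have hl : HasDerivAt (fun r => 1 - Complex.I * k * r) (-(Complex.I * k)) r := by
    simpa using ((hasDerivAt_id r).const_mul (Complex.I * k)).const_sub 1
  have hq : HasDerivAt (fun r : ℂ => c * r ^ 2) (c * (2 * r)) r := by
    simpa using (hasDerivAt_pow 2 r).const_mul c
  refine ((hasDerivAt_radialFactor hc hr).mul (hl.mul
    ((hasDerivAt_const r Complex.I).div hq (by simp [hc, hr])))).congr_deriv ?_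
  simp only [alphaFactor, Pi.mul_apply, Pi.div_apply]
  field_simp
  linear_combination radialFactor k r * Complex.I *
    (1 - 2 * r * k * Complex.I + r ^ 2 * k ^ 2 * (Complex.I ^ 2 - 1)) * Complex.I_sq

lemma greenFun_eq (m c : ℝ) (lam k : ℂ) (x : EuclideanSpace ℝ (Fin 3)) :
    greenFun m c lam k x =
      radialFactor k ‖x‖ • ((lam / (c : ℂ) ^ 2) • 1 + (m : ℂ) • diracBeta) +
        alphaFactor c k ‖x‖ • alphaDot x := by
  rw [greenFun, smul_add, smul_smul]
  rfl

lemma hasFDerivAt_alphaDot_apply (x : EuclideanSpace ℝ (Fin 3)) (a b : Fin 4) :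
    HasFDerivAt (fun y => alphaDot y a b)
      (∑ j, (EuclideanSpace.proj j : EuclideanSpace ℝ (Fin 3) →L[ℝ] ℝ).smulRight
        (diracAlpha j a b)) x := by
  convert (∑ j, (EuclideanSpace.proj j : EuclideanSpace ℝ (Fin 3) →L[ℝ] ℝ).smulRight
    (diracAlpha j a b)).hasFDerivAt using 1
  ext y
  simp [alphaDot, Matrix.sum_apply]

lemma greenFun_differentiableAt_and_fderiv {m c : ℝ} (hc : c ≠ 0) (lam k : ℂ)
    {x : EuclideanSpace ℝ (Fin 3)} (hx : x ≠ 0) (a b : Fin 4) :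
    DifferentiableAt ℝ (fun y => greenFun m c lam k y a b) x ∧
    ∀ j, fderiv ℝ (fun y => greenFun m c lam k y a b) x (EuclideanSpace.single j (1 : ℝ)) =
      ((x j : ℂ) • ((Complex.I * c * alphaFactor c k ‖x‖) •
          ((lam / (c : ℂ) ^ 2) • (1 : Matrix (Fin 4) (Fin 4) ℂ) + (m : ℂ) • diracBeta) +
        ((Complex.I / c * k ^ 2 * radialFactor k ‖x‖ - 3 * alphaFactor c k ‖x‖) /
          (‖x‖ : ℂ) ^ 2) • alphaDot x) + alphaFactor c k ‖x‖ • diracAlpha j) a b := by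
  have hc' : (c : ℂ) ≠ 0 := by exact_mod_cast hc
  have hr : (‖x‖ : ℂ) ≠ 0 := by exact_mod_cast norm_ne_zero_iff.2 hx
  have h := ((hasFDerivAt_radial hx (hasDerivAt_radialFactor (k := k) hc' hr)).mul_const
    (((lam / (c : ℂ) ^ 2) • (1 : Matrix (Fin 4) (Fin 4) ℂ) + (m : ℂ) • diracBeta) a b)).add
    ((hasFDerivAt_radial hx (hasDerivAt_alphaFactor (k := k) hc' hr)).mul
      (hasFDerivAt_alphaDot_apply x a b))
  have heq : (fun y => greenFun m c lam k y a b) = fun y =>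
      radialFactor k ‖y‖ *
        ((lam / (c : ℂ) ^ 2) • (1 : Matrix (Fin 4) (Fin 4) ℂ) + (m : ℂ) • diracBeta) a b +
      alphaFactor c k ‖y‖ * alphaDot y a b := by
    ext y
    rw [greenFun_eq]
    rfl
  rw [heq]
  refine ⟨h.differentiableAt, fun j => ?_⟩
  refine (DFunLike.congr_fun h.fderiv _).trans ?_
  simp [EuclideanSpace.inner_single_right]
  field_simp
  ring

theorem green_solves_free_dirac (m c : ℝ) (hm : 0 < m) (hc : 0 < c) (lam k : ℂ)
    (hlam : ∀ r : ℝ, (r : ℂ) = lam → -(m * c ^ 2) < r ∧ r < m * c ^ 2)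
    (hk : k ^ 2 = lam ^ 2 / (c : ℂ) ^ 2 - ((m : ℂ) * (c : ℂ)) ^ 2) (hkim : 0 < k.im) :
    (∀ x : EuclideanSpace ℝ (Fin 3), x ≠ 0 → ∀ a b : Fin 4,
      DifferentiableAt ℝ (fun y => greenFun m c lam k y a b) x) ∧
    (∀ x : EuclideanSpace ℝ (Fin 3), x ≠ 0 →
      (-(Complex.I * (c : ℂ))) • (∑ j : Fin 3, diracAlpha j *
          Matrix.of (fun a b : Fin 4 =>
            fderiv ℝ (fun y => greenFun m c lam k y a b) x (EuclideanSpace.single j (1 : ℝ))))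
        + ((m : ℂ) * (c : ℂ) ^ 2) • (diracBeta * greenFun m c lam k x)
        - lam • greenFun m c lam k x = 0) := by
  have hc0 : (c : ℂ) ≠ 0 := by exact_mod_cast hc.ne'
  refine ⟨fun x hx a b => (greenFun_differentiableAt_and_fderiv hc.ne' lam k hx a b).1,
    fun x hx => ?_⟩
  have hr : (‖x‖ : ℂ) ≠ 0 := by exact_mod_cast norm_ne_zero_iff.2 hx
  simp only [(greenFun_differentiableAt_and_fderiv hc.ne' lam k hx _ _).2]
  simp only [show ∀ M : Matrix (Fin 4) (Fin 4) ℂ,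
    Matrix.of (fun a b => M a b) = M from fun _ => rfl]
  have hk' : (c : ℂ) ^ 2 * k ^ 2 = lam ^ 2 - (m : ℂ) ^ 2 * (c : ℂ) ^ 4 := by
    rw [hk]
    field_simp
  set p := radialFactor k ‖x‖
  set q := alphaFactor c k ‖x‖
  set M := (lam / (c : ℂ) ^ 2) • (1 : Matrix (Fin 4) (Fin 4) ℂ) + (m : ℂ) • diracBeta with hM
  have hsum : ∀ N : Matrix (Fin 4) (Fin 4) ℂ,
      ∑ j, diracAlpha j * ((x j : ℂ) • N + q • diracAlpha j) =
        alphaDot x * N + (3 * q) • 1 := by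
    intro N
    simp only [mul_add, Finset.sum_add_distrib, Matrix.mul_smul, ← Finset.smul_sum,
      sum_diracAlpha_mul_self, alphaDot, Finset.sum_mul, Matrix.smul_mul, smul_smul]
    rw [mul_comm q]
  rw [hsum, greenFun_eq]
  change _ + _ • (_ * (p • M + q • _)) - _ • (p • M + q • _) = 0
  simp only [hM, mul_add, Matrix.mul_smul, alphaDot_mul_self, diracBeta_anticomm_alphaDot,
    diracBeta_mul_self, mul_one]
  match_scalars <;> field_simp
  · linear_combination -(q * lam) * Complex.I_sq
  · linear_combination -((c : ℂ) ^ 2 * q * m) * Complex.I_sq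
  · linear_combination p * hk' - (c : ℂ) ^ 2 * k ^ 2 * p * Complex.I_sq
  · ring


end
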